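/- arXiv:1810.04224 — 5 statements merged into one kernel-verified Lean document; each statement's English description precedes it below -/
import Mathlib

section
/- Let 1 < p < 5 and define m_J(λ) := inf{ J[u] : u a real Schwartz function with ∫_ℝ u'(x)² dx = λ } for λ > 0 (a real number, since J is bounded below on this constraint set). Then for all 0 < α < λ one has the strict scaling inequality m_J(λ) < (λ/α)·m_J(α); in particular λ ↦ m_J(λ)/λ is strictly decreasing on (0,∞), and the strict sub-additivity m_J(λ) < m_J(α) + m_J(λ−α) holds for all 0 < α < λ. -/
open MeasureTheory

/-- The functional `J[u] = (1/2)∫ (u''² + u²) - (1/(p+1)) ∫ |u'|^{p+1}`. -/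
noncomputable def Jfun (p : ℝ) (u : ℝ → ℝ) : ℝ :=
  (1 / 2) * (∫ x : ℝ, ((deriv (deriv u) x) ^ 2 + (u x) ^ 2))
    - (1 / (p + 1)) * ∫ x : ℝ, |deriv u x| ^ (p + 1)

/-- The cost function `m_J(λ)`: the infimum of `J` over Schwartz functions with
`∫ u'² = λ`. -/
noncomputable def mJ (p lam : ℝ) : ℝ :=
  sInf {r : ℝ | ∃ u : SchwartzMap ℝ ℝ, (∫ x : ℝ, (deriv u x) ^ 2) = lam ∧ Jfun p u = r}

open Filter Topology SchwartzMap

namespace SchwartzMap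

theorem integrable_mul_mul (f g : 𝓢(ℝ, ℝ)) : Integrable (fun x => f x * g x) :=
  (f.memLp 2).integrable_mul (g.memLp 2)

theorem integrable_sq (f : 𝓢(ℝ, ℝ)) : Integrable (fun x => f x ^ 2) :=
  (f.memLp 2).integrable_sq

theorem integrable_abs_rpow (f : 𝓢(ℝ, ℝ)) {q : ℝ} (hq : 0 < q) :
    Integrable (fun x => |f x| ^ q) := by
  have h := (f.memLp (ENNReal.ofReal q)).integrable_norm_rpow (by simpa using hq) (by simp)
  simpa [ENNReal.toReal_ofReal hq.le] using h

theorem coe_deriv (u : 𝓢(ℝ, ℝ)) : deriv u = derivCLM ℝ ℝ u := by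
  ext x; simp

/-- The pointwise bound behind the embedding `H¹(ℝ) ⊆ L^∞(ℝ)`. -/
theorem sq_le_integral (v : 𝓢(ℝ, ℝ)) {s : ℝ} (hs : 0 < s) (x : ℝ) :
    v x ^ 2 ≤ s * (∫ y, v y ^ 2) + s⁻¹ * ∫ y, deriv v y ^ 2 := by
  set w := derivCLM ℝ ℝ v with hw
  have hd : deriv v = w := coe_deriv v
  have hder : ∀ y ∈ Set.Iic x, HasDerivAt (fun y => v y ^ 2) (2 * (v y * w y)) y := by
    intro y _
    have := (v.hasDerivAt y).pow 2
    rw [hd] at this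
    exact this.congr_deriv (by norm_num; ring)
  have hint : Integrable (fun y => 2 * (v y * w y)) := (integrable_mul_mul v w).const_mul 2
  have hlim : Tendsto (fun y => v y ^ 2) atBot (𝓝 0) := by
    have := (v.tendsto_cocompact.mono_left atBot_le_cocompact).pow 2
    simpa using this
  have key := integral_Iic_of_hasDerivAt_of_tendsto' hder hint.integrableOn hlim
  have hb : ∀ y, |2 * (v y * w y)| ≤ s * v y ^ 2 + s⁻¹ * w y ^ 2 := by
    intro y
    have e : s⁻¹ * (s * v y + w y) ^ 2 = s * v y ^ 2 + s⁻¹ * w y ^ 2 + 2 * (v y * w y) := by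
      field_simp; ring
    have e' : s⁻¹ * (s * v y - w y) ^ 2 = s * v y ^ 2 + s⁻¹ * w y ^ 2 - 2 * (v y * w y) := by
      field_simp; ring
    have p1 : 0 ≤ s⁻¹ * (s * v y + w y) ^ 2 := by positivity
    have p2 : 0 ≤ s⁻¹ * (s * v y - w y) ^ 2 := by positivity
    rw [abs_le]; constructor <;> linarith
  have i1 := (integrable_sq v).const_mul s
  have i2 := (integrable_sq w).const_mul s⁻¹
  calc v x ^ 2 = ∫ y in Set.Iic x, 2 * (v y * w y) := by rw [key]; ring
    _ ≤ ∫ y in Set.Iic x, |2 * (v y * w y)| :=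
        integral_mono hint.integrableOn hint.abs.integrableOn (fun y => le_abs_self _)
    _ ≤ ∫ y, |2 * (v y * w y)| :=
        setIntegral_le_integral hint.abs (ae_of_all _ fun y => abs_nonneg _)
    _ ≤ ∫ y, (s * v y ^ 2 + s⁻¹ * w y ^ 2) := integral_mono hint.abs (i1.add i2) hb
    _ = _ := by rw [integral_add i1 i2, integral_const_mul, integral_const_mul, hd]

theorem integral_abs_rpow_le (v : 𝓢(ℝ, ℝ)) {p M : ℝ} (hp : 1 ≤ p) (hM : ∀ x, |v x| ≤ M) :
    ∫ x, |v x| ^ (p + 1) ≤ M ^ (p - 1) * ∫ x, v x ^ 2 := by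
  rw [← integral_const_mul]
  refine integral_mono (integrable_abs_rpow v (by linarith)) ((integrable_sq v).const_mul _) ?_
  intro x
  have e : |v x| ^ (p + 1) = |v x| ^ (p - 1) * v x ^ 2 := by
    rw [show p + 1 = (p - 1) + (2 : ℕ) by push_cast; ring,
      Real.rpow_add_natCast' (abs_nonneg _) (by push_cast; linarith), sq_abs]
  change |v x| ^ (p + 1) ≤ M ^ (p - 1) * v x ^ 2
  rw [e]
  gcongr
  · exact hM x

/-- Interpolation of the `L²` norm between `L¹` and `L^{p+1}`. -/
theorem le_integral_abs_rpow (v : 𝓢(ℝ, ℝ)) {p δ : ℝ} (hp : 1 ≤ p) (hδ : 0 < δ) :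
    δ ^ (p - 1) * ((∫ x, v x ^ 2) - δ * ∫ x, |v x|) ≤ ∫ x, |v x| ^ (p + 1) := by
  have i1 : Integrable (fun x => |v x|) := v.integrable.abs
  rw [← integral_const_mul, ← integral_sub (integrable_sq v) (i1.const_mul _),
    ← integral_const_mul]
  refine integral_mono (((integrable_sq v).sub (i1.const_mul _)).const_mul _)
    (integrable_abs_rpow v (by linarith)) ?_
  intro x
  change δ ^ (p - 1) * (v x ^ 2 - δ * |v x|) ≤ |v x| ^ (p + 1)
  have e : |v x| ^ (p + 1) = |v x| ^ (p - 1) * v x ^ 2 := by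
    rw [show p + 1 = (p - 1) + (2 : ℕ) by push_cast; ring,
      Real.rpow_add_natCast' (abs_nonneg _) (by push_cast; linarith), sq_abs]
  have hδp : 0 < δ ^ (p - 1) := Real.rpow_pos_of_pos hδ _
  rcases le_total (|v x|) δ with h | h
  · have : v x ^ 2 - δ * |v x| ≤ 0 := by
      rw [← sq_abs]; nlinarith [abs_nonneg (v x)]
    exact (mul_nonpos_of_nonneg_of_nonpos hδp.le this).trans (by positivity)
  · rw [e]
    have h1 : δ ^ (p - 1) ≤ |v x| ^ (p - 1) := by gcongr
    calc δ ^ (p - 1) * (v x ^ 2 - δ * |v x|) ≤ δ ^ (p - 1) * v x ^ 2 := by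
          gcongr; have := mul_nonneg hδ.le (abs_nonneg (v x)); linarith
      _ ≤ _ := by gcongr

end SchwartzMap

theorem Jfun_eq (p : ℝ) (u : 𝓢(ℝ, ℝ)) :
    Jfun p u = (∫ x, deriv u x ^ 2) + (1 / 2) * (∫ x, (deriv (deriv u) x + u x) ^ 2)
      - (1 / (p + 1)) * ∫ x, |deriv u x| ^ (p + 1) := by
  unfold Jfun
  have hparts := integral_mul_deriv_eq_neg_deriv_mul u (derivCLM ℝ ℝ u)
  rw [coe_deriv u, coe_deriv (derivCLM ℝ ℝ u)] at *
  set v := derivCLM ℝ ℝ u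
  set w := derivCLM ℝ ℝ v
  have e : ∫ x, (w x + u x) ^ 2 = (∫ x, (w x ^ 2 + u x ^ 2)) + 2 * ∫ x, u x * w x := by
    rw [← integral_const_mul, ← integral_add]
    · congr 1; ext x; ring
    · exact (integrable_sq w).add (integrable_sq u)
    · exact (integrable_mul_mul u w).const_mul 2
  have e2 : (fun x => v x * v x) = fun x => v x ^ 2 := by ext x; ring
  rw [e, hparts, e2]
  ring

theorem integral_deriv_smul_sq (c : ℝ) (u : 𝓢(ℝ, ℝ)) :
    ∫ x, deriv (c • u : 𝓢(ℝ, ℝ)) x ^ 2 = c ^ 2 * ∫ x, deriv u x ^ 2 := by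
  rw [← integral_const_mul, coe_deriv, coe_deriv, map_smul]
  simp [mul_pow]

theorem Jfun_smul (p : ℝ) {c : ℝ} (hc : 0 ≤ c) (u : 𝓢(ℝ, ℝ)) :
    Jfun p (c • u : 𝓢(ℝ, ℝ)) =
      c ^ 2 * ((∫ x, deriv u x ^ 2) + (1 / 2) * (∫ x, (deriv (deriv u) x + u x) ^ 2))
        - c ^ (p + 1) * ((1 / (p + 1)) * ∫ x, |deriv u x| ^ (p + 1)) := by
  rw [Jfun_eq, integral_deriv_smul_sq]
  have h1 : ∫ x, (deriv (deriv (c • u : 𝓢(ℝ, ℝ))) x + (c • u : 𝓢(ℝ, ℝ)) x) ^ 2 =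
      c ^ 2 * ∫ x, (deriv (deriv u) x + u x) ^ 2 := by
    rw [← integral_const_mul, coe_deriv, coe_deriv, coe_deriv, coe_deriv, map_smul, map_smul]
    congr 1; ext x; simp only [smul_apply, smul_eq_mul]; ring
  have h2 : ∫ x, |deriv (c • u : 𝓢(ℝ, ℝ)) x| ^ (p + 1) =
      c ^ (p + 1) * ∫ x, |deriv u x| ^ (p + 1) := by
    rw [← integral_const_mul, coe_deriv, coe_deriv, map_smul]
    congr 1; ext x
    rw [smul_apply, smul_eq_mul, abs_mul, abs_of_nonneg hc, Real.mul_rpow hc (abs_nonneg _)]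
  rw [h1, h2]; ring

theorem exists_mul_rpow_le {C r : ℝ} (hC : 0 ≤ C) (hr0 : 0 ≤ r) (hr1 : r < 1) :
    ∃ B : ℝ, ∀ y : ℝ, 0 ≤ y → C * y ^ r ≤ y / 2 + B := by
  have h : Tendsto (fun y : ℝ => C * y ^ (-(1 - r))) atTop (𝓝 (C * 0)) :=
    (tendsto_rpow_neg_atTop (by linarith)).const_mul C
  rw [mul_zero] at h
  obtain ⟨Y, hY⟩ :=
    (h.eventually (Iic_mem_nhds (by norm_num : (0 : ℝ) < 1 / 2))).exists_forall_of_atTop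
  refine ⟨C * (max Y 1) ^ r, fun y hy => ?_⟩
  have hB : 0 ≤ C * (max Y 1) ^ r := by positivity
  rcases le_total (max Y 1) y with hle | hle
  · have hYy : Y ≤ y := (le_max_left _ _).trans hle
    have hy0 : 0 < y := lt_of_lt_of_le one_pos ((le_max_right _ _).trans hle)
    have h1 : C * y ^ (-(1 - r)) ≤ 1 / 2 := (hY y hYy)
    have e : y ^ r = y ^ (-(1 - r)) * y := by
      rw [← Real.rpow_add_one hy0.ne']; congr 1; ring
    rw [e, ← mul_assoc]
    nlinarith
  · have : C * y ^ r ≤ C * (max Y 1) ^ r := by gcongr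
    linarith

theorem bddBelow_Jfun {p : ℝ} (hp1 : 1 < p) (hp5 : p < 5) (lam : ℝ) :
    BddBelow {r : ℝ | ∃ u : 𝓢(ℝ, ℝ), (∫ x : ℝ, (deriv u x) ^ 2) = lam ∧ Jfun p u = r} := by
  rcases lt_or_ge lam 0 with hl | hl
  · refine ⟨0, ?_⟩
    rintro r ⟨u, hu, -⟩
    have : 0 ≤ ∫ x : ℝ, (deriv u x) ^ 2 := integral_nonneg fun x => sq_nonneg _
    linarith
  set C : ℝ := (1 / (p + 1)) * ((lam + 1) ^ ((p - 1) / 2) * lam) with hC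
  obtain ⟨B, hB⟩ := exists_mul_rpow_le (C := C) (r := (p - 1) / 4) (by positivity)
    (by linarith) (by linarith)
  refine ⟨-(1 / 2 + B), ?_⟩
  rintro r ⟨u, hu, rfl⟩
  set v := derivCLM ℝ ℝ u with hv
  have hd := coe_deriv u
  rw [← hv] at hd
  have hsup := fun (x : ℝ) (s : ℝ) (hs : 0 < s) => sq_le_integral v hs x
  have hd2 := coe_deriv v
  set w := derivCLM ℝ ℝ v with hw
  unfold Jfun
  rw [hd] at hu ⊢
  rw [hd2] at hsup ⊢
  rw [integral_add (integrable_sq w) (integrable_sq u)]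
  rw [hu] at hsup
  set K := ∫ y, w y ^ 2
  have hK : 0 ≤ K := integral_nonneg fun x => sq_nonneg _
  have hU : 0 ≤ ∫ y, u y ^ 2 := integral_nonneg fun x => sq_nonneg _
  set s := (1 + K) ^ (1 / 2 : ℝ) with hs
  have hs0 : 0 < s := by positivity
  have hss : s * s = 1 + K := by
    rw [hs, ← Real.rpow_add (by positivity)]; norm_num
  have hM2 : ∀ x, v x ^ 2 ≤ (lam + 1) * s := by
    intro x
    have h1 : s⁻¹ * K ≤ s := by
      rw [inv_mul_le_iff₀ hs0]; linarith
    have := hsup x s hs0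
    nlinarith
  have hM : ∀ x, |v x| ≤ ((lam + 1) * s) ^ (1 / 2 : ℝ) := by
    intro x
    rw [← Real.sqrt_eq_rpow]
    exact Real.abs_le_sqrt (hM2 x)
  have hP := integral_abs_rpow_le v hp1.le hM
  rw [hu] at hP
  have e : (((lam + 1) * s) ^ (1 / 2 : ℝ)) ^ (p - 1) =
      (lam + 1) ^ ((p - 1) / 2) * (1 + K) ^ ((p - 1) / 4) := by
    rw [← Real.rpow_mul (by positivity), Real.mul_rpow (by positivity) hs0.le, hs,
      ← Real.rpow_mul (by positivity)]
    congr 2 <;> ring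
  rw [e] at hP
  have h2 := hB (1 + K) (by positivity)
  have h3 : (1 / (p + 1)) * ∫ x, |v x| ^ (p + 1) ≤ C * (1 + K) ^ ((p - 1) / 4) := by
    rw [hC]
    calc _ ≤ (1 / (p + 1)) * ((lam + 1) ^ ((p - 1) / 2) * (1 + K) ^ ((p - 1) / 4) * lam) := by
          gcongr
      _ = _ := by ring
  linarith

theorem exists_modulated (f : 𝓢(ℝ, ℝ)) (hf : HasCompactSupport f) {ε : ℝ} (hε : 0 < ε) (θ : ℝ) :
    ∃ u : 𝓢(ℝ, ℝ), ∀ x, u x = f (ε * x) * Real.cos (x + θ) := by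
  have hs : HasCompactSupport (fun x => f (ε * x)) :=
    hf.comp_homeomorph (Homeomorph.mulLeft₀ ε hε.ne')
  have hs' : HasCompactSupport (fun x => f (ε * x) * Real.cos (x + θ)) :=
    hs.mul_right
  have hc : ContDiff ℝ (⊤ : ℕ∞) (fun x => f (ε * x) * Real.cos (x + θ)) := by
    have := f.smooth (⊤ : ℕ∞)
    fun_prop
  exact ⟨hs'.toSchwartzMap hc, fun x => rfl⟩

theorem deriv_modulated {f u : 𝓢(ℝ, ℝ)} {ε θ : ℝ}
    (hu : ∀ x, u x = f (ε * x) * Real.cos (x + θ)) (x : ℝ) :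
    deriv u x = ε * deriv f (ε * x) * Real.cos (x + θ) - f (ε * x) * Real.sin (x + θ) := by
  have h1 : HasDerivAt (fun x => f (ε * x)) (deriv f (ε * x) * (ε * 1)) x :=
    (f.hasDerivAt (ε * x)).comp x ((hasDerivAt_id x).const_mul ε)
  have h2 : HasDerivAt (fun x => Real.cos (x + θ)) (-Real.sin (x + θ) * 1) x :=
    HasDerivAt.comp (h := fun x => x + θ) x (Real.hasDerivAt_cos (x + θ))
      ((hasDerivAt_id x).add_const θ)
  rw [funext hu]
  refine (h1.mul h2).deriv.trans ?_
  ring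

theorem deriv_deriv_modulated {f u : 𝓢(ℝ, ℝ)} {ε θ : ℝ}
    (hu : ∀ x, u x = f (ε * x) * Real.cos (x + θ)) (x : ℝ) :
    deriv (deriv u) x + u x = ε ^ 2 * deriv (deriv f) (ε * x) * Real.cos (x + θ)
      - 2 * ε * deriv f (ε * x) * Real.sin (x + θ) := by
  have h0 : HasDerivAt (fun x => f (ε * x)) (deriv f (ε * x) * (ε * 1)) x :=
    (f.hasDerivAt (ε * x)).comp x ((hasDerivAt_id x).const_mul ε)
  have hd : HasDerivAt (deriv f) (deriv (deriv f) (ε * x)) (ε * x) := by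
    rw [coe_deriv f]; exact (derivCLM ℝ ℝ f).hasDerivAt _
  have h1 : HasDerivAt (fun x => deriv f (ε * x)) (deriv (deriv f) (ε * x) * (ε * 1)) x :=
    hd.comp x ((hasDerivAt_id x).const_mul ε)
  have h2 : HasDerivAt (fun x => Real.cos (x + θ)) (-Real.sin (x + θ) * 1) x :=
    HasDerivAt.comp (h := fun x => x + θ) x (Real.hasDerivAt_cos (x + θ))
      ((hasDerivAt_id x).add_const θ)
  have h3 : HasDerivAt (fun x => Real.sin (x + θ)) (Real.cos (x + θ) * 1) x :=
    HasDerivAt.comp (h := fun x => x + θ) x (Real.hasDerivAt_sin (x + θ))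
      ((hasDerivAt_id x).add_const θ)
  have h4 := (((h1.const_mul ε).mul h2).sub (h0.mul h3)).deriv
  rw [funext (deriv_modulated hu), hu]
  refine (congrArg (· + f (ε * x) * Real.cos (x + θ)) h4).trans ?_
  ring

/-- Slowly modulated oscillations almost saturate `½ ∫ (u''² + u²) ≥ ∫ u'²`. -/
theorem exists_oscillating :
    ∃ A a : ℝ, 0 < A ∧ 0 < a ∧ ∀ ε : ℝ, 0 < ε → ε ≤ 1 → ∃ u : 𝓢(ℝ, ℝ),
      (∫ x, (deriv (deriv u) x + u x) ^ 2) ≤ A * ε ∧ a / ε ≤ (∫ x, deriv u x ^ 2) ∧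
      (∫ x, deriv u x ^ 2) ≤ A / ε ∧ (∫ x, |deriv u x|) ≤ A / ε := by
  let φ : ContDiffBump (0 : ℝ) := default
  let f : 𝓢(ℝ, ℝ) := φ.hasCompactSupport.toSchwartzMap φ.contDiff
  have hf : HasCompactSupport f := φ.hasCompactSupport
  have hf0 : f 0 ≠ 0 := by
    change φ 0 ≠ 0
    rw [φ.one_of_mem_closedBall (by simpa using φ.rIn_pos.le)]
    exact one_ne_zero
  have hd := coe_deriv f
  set g := derivCLM ℝ ℝ f
  have hd2 := coe_deriv g
  set h := derivCLM ℝ ℝ g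
  have Iff : 0 < ∫ x, f x ^ 2 :=
    (f.continuous.pow 2).integral_pos_of_hasCompactSupport_nonneg_nonzero
      (hf.comp_left (g := fun y => y ^ 2) (by norm_num)) (fun x => sq_nonneg _)
      (x := 0) (by simpa using hf0)
  have i1 : Integrable (fun x => 2 * h x ^ 2 + 8 * g x ^ 2) :=
    ((integrable_sq h).const_mul 2).add ((integrable_sq g).const_mul 8)
  have i2 : Integrable (fun x => 2 * (g x ^ 2 + f x ^ 2)) :=
    ((integrable_sq g).add (integrable_sq f)).const_mul 2
  have i3 : Integrable (fun x => |g x| + |f x|) := g.integrable.abs.add f.integrable.abs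
  set A1 := ∫ x, (2 * h x ^ 2 + 8 * g x ^ 2)
  set A2 := ∫ x, 2 * (g x ^ 2 + f x ^ 2)
  set A3 := ∫ x, (|g x| + |f x|)
  have hA1 : 0 ≤ A1 := integral_nonneg fun x => by positivity
  have hA2 : 0 ≤ A2 := integral_nonneg fun x => by positivity
  have hA3 : 0 ≤ A3 := integral_nonneg fun x => by positivity
  refine ⟨A1 + A2 + A3 + 1, (∫ x, f x ^ 2) / 2, by positivity, by positivity, ?_⟩
  intro ε hε hε1
  have scale : ∀ F : ℝ → ℝ, ∫ x, F (ε * x) = (∫ x, F x) / ε := by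
    intro F
    rw [Measure.integral_comp_mul_left, abs_of_pos (inv_pos.2 hε), smul_eq_mul]
    field_simp
  have hupper : ∀ (u : 𝓢(ℝ, ℝ)) (θ : ℝ), (∀ x, u x = f (ε * x) * Real.cos (x + θ)) →
      (∫ x, (deriv (deriv u) x + u x) ^ 2) ≤ (A1 + A2 + A3 + 1) * ε ∧
      (∫ x, deriv u x ^ 2) ≤ (A1 + A2 + A3 + 1) / ε ∧
      (∫ x, |deriv u x|) ≤ (A1 + A2 + A3 + 1) / ε := by
    intro u θ hu
    have e1 := deriv_modulated hu
    have e2 := deriv_deriv_modulated hu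
    have hv := coe_deriv u
    set v := derivCLM ℝ ℝ u
    have hw := coe_deriv v
    set w := derivCLM ℝ ℝ v
    rw [hd, hv, hw, hd2] at e2
    rw [hd, hv] at e1
    rw [hv, hw]
    refine ⟨?_, ?_, ?_⟩
    · calc (∫ x, (w x + u x) ^ 2)
          ≤ ∫ x, ε ^ 2 * (2 * h (ε * x) ^ 2 + 8 * g (ε * x) ^ 2) := by
            refine integral_mono (integrable_sq (w + u))
              ((i1.comp_mul_left' hε.ne').const_mul _) fun x => ?_
            change (w x + u x) ^ 2 ≤ ε ^ 2 * (2 * h (ε * x) ^ 2 + 8 * g (ε * x) ^ 2)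
            rw [e2]
            have c1 := Real.cos_sq_le_one (x + θ)
            have c2 := Real.sin_sq_le_one (x + θ)
            set a := h (ε * x)
            set b := g (ε * x)
            set C := Real.cos (x + θ)
            set S := Real.sin (x + θ)
            have t1 : (ε * a * C) ^ 2 ≤ a ^ 2 := by
              have : ε ^ 2 * C ^ 2 ≤ 1 := mul_le_one₀ (by nlinarith) (sq_nonneg _) c1
              nlinarith [sq_nonneg a]
            have t2 : (b * S) ^ 2 ≤ b ^ 2 := by nlinarith [sq_nonneg b]
            have t3 : (ε ^ 2 * a * C - 2 * ε * b * S) ^ 2 =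
              ε ^ 2 * (ε * a * C - 2 * (b * S)) ^ 2 := by ring
            rw [t3]
            gcongr
            nlinarith [sq_nonneg (ε * a * C + 2 * (b * S))]
        _ = ε * A1 := by
            rw [integral_const_mul, scale (fun x => 2 * h x ^ 2 + 8 * g x ^ 2)]
            field_simp
            rfl
        _ ≤ _ := by nlinarith
    · calc (∫ x, v x ^ 2) ≤ ∫ x, 2 * (g (ε * x) ^ 2 + f (ε * x) ^ 2) := by
            refine integral_mono (integrable_sq v) (i2.comp_mul_left' hε.ne') fun x => ?_
            change v x ^ 2 ≤ 2 * (g (ε * x) ^ 2 + f (ε * x) ^ 2)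
            rw [e1]
            have c1 := Real.cos_sq_le_one (x + θ)
            have c2 := Real.sin_sq_le_one (x + θ)
            set a := f (ε * x)
            set b := g (ε * x)
            set C := Real.cos (x + θ)
            set S := Real.sin (x + θ)
            have t1 : (ε * b * C) ^ 2 ≤ b ^ 2 := by
              have : ε ^ 2 * C ^ 2 ≤ 1 := mul_le_one₀ (by nlinarith) (sq_nonneg _) c1
              nlinarith [sq_nonneg b]
            have t2 : (a * S) ^ 2 ≤ a ^ 2 := by nlinarith [sq_nonneg a]
            nlinarith [sq_nonneg (ε * b * C + a * S)]
        _ = A2 / ε := scale (fun x => 2 * (g x ^ 2 + f x ^ 2))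
        _ ≤ _ := by gcongr; linarith
    · calc (∫ x, |v x|) ≤ ∫ x, (|g (ε * x)| + |f (ε * x)|) := by
            refine integral_mono v.integrable.abs (i3.comp_mul_left' hε.ne') fun x => ?_
            change |v x| ≤ |g (ε * x)| + |f (ε * x)|
            rw [e1]
            refine (abs_sub _ _).trans (add_le_add ?_ ?_)
            · rw [abs_mul, abs_mul, abs_of_pos hε]
              have := Real.abs_cos_le_one (x + θ)
              have h3 : ε * |g (ε * x)| ≤ |g (ε * x)| :=
                mul_le_of_le_one_left (abs_nonneg _) hε1
              exact (mul_le_of_le_one_right (by positivity) this).trans h3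
            · rw [abs_mul]
              exact mul_le_of_le_one_right (abs_nonneg _) (Real.abs_sin_le_one _)
        _ = A3 / ε := scale (fun x => |g x| + |f x|)
        _ ≤ _ := by gcongr; linarith
  obtain ⟨u₁, hu₁⟩ := exists_modulated f hf hε 0
  obtain ⟨u₂, hu₂⟩ := exists_modulated f hf hε (Real.pi / 2)
  have hsum : (∫ x, f x ^ 2) / ε ≤ (∫ x, deriv u₁ x ^ 2) + ∫ x, deriv u₂ x ^ 2 := by
    have e1 := deriv_modulated hu₁
    have e2 := deriv_modulated hu₂
    have hi1 := integrable_sq (derivCLM ℝ ℝ u₁)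
    have hi2 := integrable_sq (derivCLM ℝ ℝ u₂)
    rw [← coe_deriv] at hi1 hi2
    rw [← integral_add hi1 hi2, ← scale (fun x => f x ^ 2)]
    refine integral_mono ((integrable_sq f).comp_mul_left' hε.ne') (hi1.add hi2) fun x => ?_
    change f (ε * x) ^ 2 ≤ deriv u₁ x ^ 2 + deriv u₂ x ^ 2
    rw [e1, e2, Real.cos_add_pi_div_two, Real.sin_add_pi_div_two, add_zero]
    have c := Real.sin_sq_add_cos_sq x
    set S := Real.sin x
    set C := Real.cos x
    have : (ε * deriv f (ε * x) * C - f (ε * x) * S) ^ 2 +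
        (ε * deriv f (ε * x) * -S - f (ε * x) * C) ^ 2 =
        ((ε * deriv f (ε * x)) ^ 2 + f (ε * x) ^ 2) * (S ^ 2 + C ^ 2) := by ring
    rw [this, c]
    nlinarith [sq_nonneg (ε * deriv f (ε * x))]
  rcases le_total (∫ x, deriv u₁ x ^ 2) (∫ x, deriv u₂ x ^ 2) with hle | hle
  · obtain ⟨b1, b2, b3⟩ := hupper u₂ _ hu₂
    refine ⟨u₂, b1, ?_, b2, b3⟩
    rw [div_right_comm]; linarith
  · obtain ⟨b1, b2, b3⟩ := hupper u₁ _ hu₁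
    refine ⟨u₁, b1, ?_, b2, b3⟩
    rw [div_right_comm]; linarith

theorem exists_Jfun_lt {p : ℝ} (hp1 : 1 < p) (hp5 : p < 5) {α : ℝ} (hα : 0 < α) :
    ∃ u : 𝓢(ℝ, ℝ), (∫ x : ℝ, (deriv u x) ^ 2) = α ∧ Jfun p u < α := by
  obtain ⟨A, a, hA, ha, hosc⟩ := exists_oscillating
  set δ := a / (2 * A) with hδ
  have hδ0 : 0 < δ := by positivity
  set c₀ := δ ^ (p - 1) * (a / 2) with hc₀
  have hc₀0 : 0 < c₀ := by positivity
  set r := (p - 1) / 2 with hr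
  set κ := (α / A) ^ r * c₀ * (1 / (p + 1)) with hκ
  have hκ0 : 0 < κ := by positivity
  obtain ⟨ε, hε0, hε1, hε⟩ : ∃ ε : ℝ, 0 < ε ∧ ε ≤ 1 ∧ A / 2 * ε ^ (2 - r) < κ := by
    have hcont : ContinuousAt (fun ε : ℝ => A / 2 * ε ^ (2 - r)) 0 :=
      (Real.continuousAt_rpow_const 0 (2 - r) (Or.inr (by linarith))).const_mul _
    have h0 : A / 2 * (0 : ℝ) ^ (2 - r) < κ := by
      rw [Real.zero_rpow (by linarith)]; simpa using hκ0
    have h1 : ∀ᶠ ε in 𝓝[>] (0 : ℝ), A / 2 * ε ^ (2 - r) < κ :=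
      (hcont.eventually (Iio_mem_nhds h0)).filter_mono nhdsWithin_le_nhds
    obtain ⟨ε, h2, h3⟩ := (h1.and (Ioc_mem_nhdsGT one_pos)).exists
    exact ⟨ε, h3.1, h3.2, h2⟩
  obtain ⟨u, hQ, hN1, hN2, hL1⟩ := hosc ε hε0 hε1
  have hP := le_integral_abs_rpow (derivCLM ℝ ℝ u) hp1.le hδ0
  rw [← coe_deriv] at hP
  have hJ := fun (c : ℝ) (hc : 0 ≤ c) => Jfun_smul p hc u
  have hI := fun (c : ℝ) => integral_deriv_smul_sq c u
  set N := ∫ x, deriv u x ^ 2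
  set Q := ∫ x, (deriv (deriv u) x + u x) ^ 2
  set L := ∫ x, |deriv u x|
  set P := ∫ x, |deriv u x| ^ (p + 1)
  have hN0 : 0 < N := lt_of_lt_of_le (by positivity) hN1
  have hP' : c₀ / ε ≤ P := by
    refine le_trans ?_ hP
    have : δ * L ≤ a / 2 / ε := by
      calc δ * L ≤ δ * (A / ε) := by gcongr
        _ = _ := by rw [hδ]; field_simp
    have h4 : a / 2 / ε = a / ε - a / 2 / ε := by ring
    rw [hc₀, mul_div_assoc]
    gcongr
    linarith
  set t := α / N with ht
  have ht0 : 0 < t := by positivity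
  have htl : α / A * ε ≤ t := by
    rw [ht, le_div_iff₀ hN0]
    calc α / A * ε * N ≤ α / A * ε * (A / ε) := by gcongr
      _ = α := by field_simp
  have hsq : Real.sqrt t ^ 2 = t := Real.sq_sqrt ht0.le
  have hpow : Real.sqrt t ^ (p + 1) = t * t ^ r := by
    rw [Real.sqrt_eq_rpow, ← Real.rpow_mul ht0.le, ← Real.rpow_one_add' ht0.le (by linarith)]
    congr 1; rw [hr]; ring
  refine ⟨Real.sqrt t • u, ?_, ?_⟩
  · rw [hI, hsq, ht]; field_simp
  · rw [hJ _ (Real.sqrt_nonneg t), hsq, hpow]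
    have key : (1 / 2) * Q < t ^ r * ((1 / (p + 1)) * P) := by
      calc (1 / 2) * Q ≤ (1 / 2) * (A * ε) := by gcongr
        _ = (A / 2 * ε ^ (2 - r)) * (ε ^ r / ε) := by
            have : ε ^ (2 - r) * ε ^ r = ε * ε := by
              rw [← Real.rpow_add hε0, sub_add_cancel, Real.rpow_two, pow_two]
            field_simp
            linear_combination (-1) * this
        _ < κ * (ε ^ r / ε) := by gcongr
        _ = (α / A * ε) ^ r * ((1 / (p + 1)) * (c₀ / ε)) := by
            rw [Real.mul_rpow (by positivity) hε0.le, hκ]; ring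
        _ ≤ t ^ r * ((1 / (p + 1)) * P) := by gcongr
    have e : t * N = α := by rw [ht]; field_simp
    nlinarith [mul_lt_mul_of_pos_left key ht0]

theorem mJ_lt_self {p : ℝ} (hp1 : 1 < p) (hp5 : p < 5) {α : ℝ} (hα : 0 < α) : mJ p α < α := by
  obtain ⟨u, hu, hJ⟩ := exists_Jfun_lt hp1 hp5 hα
  exact (csInf_le (bddBelow_Jfun hp1 hp5 α) ⟨u, hu, rfl⟩).trans_lt hJ

theorem mJ_lt_mul_mJ {p : ℝ} (hp1 : 1 < p) (hp5 : p < 5) {lam α : ℝ} (hα : 0 < α)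
    (hlam : α < lam) : mJ p lam < (lam / α) * mJ p α := by
  set s := lam / α with hs
  have hs1 : 1 < s := (one_lt_div hα).2 hlam
  set c := Real.sqrt s with hc
  have hc1 : 1 < c := by rw [hc, Real.lt_sqrt zero_le_one]; simpa using hs1
  have hc2 : c ^ 2 = s := Real.sq_sqrt (by linarith)
  have hcp : c ^ (p + 1) = s * c ^ (p - 1) := by
    rw [← hc2, ← Real.rpow_two, ← Real.rpow_add (by linarith)]
    congr 1; ring
  have hk : 0 < c ^ (p - 1) - 1 := sub_pos.2 (Real.one_lt_rpow hc1 (by linarith))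
  set k := c ^ (p - 1) - 1
  set d := α - mJ p α with hd
  have hd0 : 0 < d := sub_pos.2 (mJ_lt_self hp1 hp5 hα)
  obtain ⟨u₀, hu₀, -⟩ := exists_Jfun_lt hp1 hp5 hα
  set η := min (d / 2) (k * d / 2) with hη
  have hη0 : 0 < η := by positivity
  obtain ⟨_, ⟨u, hu, rfl⟩, hlt⟩ := exists_lt_of_csInf_lt (b := mJ p α + η)
    (s := {r : ℝ | ∃ u : 𝓢(ℝ, ℝ), (∫ x : ℝ, (deriv u x) ^ 2) = α ∧ Jfun p u = r})
    ⟨_, u₀, hu₀, rfl⟩ (show mJ p α < mJ p α + η by linarith)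
  have hle : mJ p lam ≤ Jfun p (c • u : 𝓢(ℝ, ℝ)) := by
    refine csInf_le (bddBelow_Jfun hp1 hp5 lam) ⟨c • u, ?_, rfl⟩
    rw [integral_deriv_smul_sq, hu, hc2, hs]; field_simp
  rw [Jfun_smul p (by linarith), hcp, hc2, hu] at hle
  rw [Jfun_eq, hu] at hlt
  have hQ : 0 ≤ ∫ x, (deriv (deriv u) x + u x) ^ 2 := integral_nonneg fun x => sq_nonneg _
  set Q := ∫ x, (deriv (deriv u) x + u x) ^ 2
  set R := (1 / (p + 1)) * ∫ x, |deriv u x| ^ (p + 1)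
  have hη1 : η ≤ d / 2 := min_le_left _ _
  have hη2 : η ≤ k * d / 2 := min_le_right _ _
  have hR : d / 2 < R := by linarith
  have h1 : k * (d / 2) < k * R := mul_lt_mul_of_pos_left hR hk
  have h2 : α + 1 / 2 * Q - c ^ (p - 1) * R < mJ p α := by
    have : c ^ (p - 1) * R = R + k * R := by ring
    linarith
  have h3 := mul_lt_mul_of_pos_left h2 (by linarith : 0 < s)
  linarith

/-- Strict scaling inequality, strict monotonicity of `λ ↦ m_J(λ)/λ`, and strict
sub-additivity of `m_J` for `1 < p < 5`. -/
theorem mJ_strict_subadditive (p : ℝ) (hp1 : 1 < p) (hp5 : p < 5) :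
    (∀ lam α : ℝ, 0 < α → α < lam → mJ p lam < (lam / α) * mJ p α) ∧
    StrictAntiOn (fun lam : ℝ => mJ p lam / lam) (Set.Ioi 0) ∧
    (∀ lam α : ℝ, 0 < α → α < lam → mJ p lam < mJ p α + mJ p (lam - α)) := by
  have anti : ∀ lam α : ℝ, 0 < α → α < lam → mJ p lam / lam < mJ p α / α := by
    intro lam α hα hlt
    rw [div_lt_iff₀ (hα.trans hlt)]
    calc mJ p lam < (lam / α) * mJ p α := mJ_lt_mul_mJ hp1 hp5 hα hlt
      _ = _ := by ring
  refine ⟨fun lam α hα hlt => mJ_lt_mul_mJ hp1 hp5 hα hlt,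
    fun α hα lam _ hlt => anti lam α hα hlt, fun lam α hα hlt => ?_⟩
  have h1 := (lt_div_iff₀ hα).1 (anti lam α hα hlt)
  have h2 := (lt_div_iff₀ (sub_pos.2 hlt)).1 (anti lam (lam - α) (sub_pos.2 hlt) (by linarith))
  have h3 : mJ p lam = mJ p lam / lam * α + mJ p lam / lam * (lam - α) := by
    have : lam ≠ 0 := (hα.trans hlt).ne'
    field_simp
    ring
  linarith
end

section
/- Let p > 1 and ω ∈ ℝ, and let φ : ℝ → ℝ be four times continuously differentiable with constants C > 0 and κ > 0 such that |φ^{(k)}(x)| ≤ C e^{−κ|x|} for all x ∈ ℝ and all k = 0,1,2,3,4. Suppose φ satisfies φ''''(x) + ωφ''(x) + φ(x) + p·sign(φ'(x))|φ'(x)|^{p−1}φ''(x) = 0 for all x (i.e. φ'''' + ωφ'' + φ + ∂_x(|φ'|^{p}) = 0). If I[φ] < ∫_ℝ φ'(x)² dx and ∫_ℝ |φ'(x)|^{p}φ'(x) dx > 0, then ω < 2. -/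
open MeasureTheory

/-- The functional `I[u] = (1/2)∫ (u''² + u²) - (1/(p+1)) ∫ |u'|^p u'`. -/
noncomputable def Ifun (p : ℝ) (u : ℝ → ℝ) : ℝ :=
  (1 / 2) * (∫ x : ℝ, ((deriv (deriv u) x) ^ 2 + (u x) ^ 2))
    - (1 / (p + 1)) * ∫ x : ℝ, |deriv u x| ^ p * deriv u x

open Filter Topology in
/-- The weight `exp (-κ|x|)` vanishes at infinity. -/
theorem tendsto_exp_neg_mul_abs_cocompact {κ : ℝ} (hκ : 0 < κ) :
    Tendsto (fun x : ℝ => Real.exp (-κ * |x|)) (cocompact ℝ) (𝓝 0) := by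
  have h : Tendsto (fun x : ℝ => |x|) (cocompact ℝ) atTop := tendsto_norm_cocompact_atTop
  exact Real.tendsto_exp_atBot.comp (h.const_mul_atTop_of_neg (neg_lt_zero.mpr hκ))

/-- The weight `exp (-κ|x|)` is integrable. -/
theorem integrable_exp_neg_mul_abs {κ : ℝ} (hκ : 0 < κ) :
    Integrable (fun x : ℝ => Real.exp (-κ * |x|)) := by
  rw [← integrableOn_univ, ← Set.Iic_union_Ioi (a := (0 : ℝ))]
  refine IntegrableOn.union ?_ ?_
  · refine (integrableOn_exp_mul_Iic hκ 0).congr_fun (fun x hx => ?_) measurableSet_Iic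
    simp [abs_of_nonpos (Set.mem_Iic.mp hx)]
  · refine (integrableOn_exp_mul_Ioi (neg_lt_zero.mpr hκ) 0).congr_fun (fun x hx => ?_)
      measurableSet_Ioi
    simp [abs_of_pos (Set.mem_Ioi.mp hx)]

/-- The derivative of `|y|^p`, written with the sign function. -/
theorem hasDerivAt_abs_rpow_sign (y : ℝ) {p : ℝ} (hp : 1 < p) :
    HasDerivAt (fun y : ℝ => |y| ^ p) (p * Real.sign y * |y| ^ (p - 1)) y := by
  convert hasDerivAt_abs_rpow y hp using 1
  rcases eq_or_ne y 0 with rfl | hy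
  · simp
  · have h : |y| ^ (p - 1) = |y| ^ (p - 2) * |y| := by
      rw [← Real.rpow_add_one (abs_ne_zero.mpr hy)]
      ring_nf
    have hs : Real.sign y * |y| = y := by
      rcases lt_or_gt_of_ne hy with h0 | h0
      · simp [Real.sign_of_neg h0, abs_of_neg h0]
      · simp [Real.sign_of_pos h0, abs_of_pos h0]
    rw [h]
    linear_combination p * |y| ^ (p - 2) * hs

open Filter Topology in
/-- Testing `φ'''' + ωφ'' + φ + ∂_x(|φ'|^p) = 0` against `φ`. -/
theorem integral_energy_identity {p ω : ℝ} (hp : 1 < p) {φ : ℝ → ℝ} (hφ : ContDiff ℝ 4 φ)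
    {C κ : ℝ} (hκ : 0 < κ)
    (hdecay : ∀ k ≤ 4, ∀ x : ℝ, |iteratedDeriv k φ x| ≤ C * Real.exp (-κ * |x|))
    (heq : ∀ x : ℝ, iteratedDeriv 4 φ x + ω * iteratedDeriv 2 φ x + φ x
      + p * Real.sign (deriv φ x) * |deriv φ x| ^ (p - 1) * iteratedDeriv 2 φ x = 0) :
    ∫ x : ℝ, ((deriv (deriv φ) x) ^ 2 + (φ x) ^ 2)
      = ω * (∫ x : ℝ, (deriv φ x) ^ 2) + ∫ x : ℝ, |deriv φ x| ^ p * deriv φ x := by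
  have hcont : ∀ k ≤ 4, Continuous (iteratedDeriv k φ) := fun k hk =>
    hφ.continuous_iteratedDeriv k (by exact_mod_cast hk)
  have hder : ∀ k < 4, ∀ x, HasDerivAt (iteratedDeriv k φ) (iteratedDeriv (k + 1) φ x) x := by
    intro k hk x
    rw [iteratedDeriv_succ]
    exact (hφ.differentiable_iteratedDeriv k (by exact_mod_cast hk) x).hasDerivAt
  have hint : ∀ k ≤ 4, Integrable (iteratedDeriv k φ) := fun k hk =>
    ((integrable_exp_neg_mul_abs hκ).const_mul C).mono' (hcont k hk).aestronglyMeasurable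
      (Eventually.of_forall (hdecay k hk))
  have hlim : ∀ k ≤ 4, Tendsto (iteratedDeriv k φ) (cocompact ℝ) (𝓝 0) := fun k hk =>
    squeeze_zero_norm (hdecay k hk)
      (by simpa using (tendsto_exp_neg_mul_abs_cocompact hκ).const_mul C)
  have hC : 0 ≤ C := by
    have := (abs_nonneg _).trans (hdecay 0 (by norm_num) 0)
    simpa using this
  have hbdd : ∀ k ≤ 4, ∀ x, |iteratedDeriv k φ x| ≤ C := fun k hk x =>
    (hdecay k hk x).trans (mul_le_of_le_one_right hC (Real.exp_le_one_iff.mpr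
      (by nlinarith [abs_nonneg x])))
  have hsq : ∀ k ≤ 4, Integrable (fun x => iteratedDeriv k φ x ^ 2) := fun k hk => by
    simpa only [sq] using (hint k hk).bdd_mul (hcont k hk).aestronglyMeasurable
      (Eventually.of_forall (hbdd k hk))
  have hcontp : Continuous (fun x => |iteratedDeriv 1 φ x| ^ p) :=
    (hcont 1 (by norm_num)).abs.rpow_const fun _ => Or.inr (by linarith)
  have hN : Integrable (fun x => |iteratedDeriv 1 φ x| ^ p * iteratedDeriv 1 φ x) :=
    (hint 1 (by norm_num)).bdd_mul (c := C ^ p) hcontp.aestronglyMeasurable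
      (Eventually.of_forall fun x => by
        rw [Real.norm_of_nonneg (by positivity)]
        exact Real.rpow_le_rpow (abs_nonneg _) (hbdd 1 (by norm_num) x) (by linarith))
  have hF : ∀ x, HasDerivAt
      (fun x => iteratedDeriv 3 φ x * iteratedDeriv 0 φ x
        - iteratedDeriv 2 φ x * iteratedDeriv 1 φ x
        + ω * (iteratedDeriv 1 φ x * iteratedDeriv 0 φ x)
        + |iteratedDeriv 1 φ x| ^ p * iteratedDeriv 0 φ x)
      (ω * iteratedDeriv 1 φ x ^ 2 + |iteratedDeriv 1 φ x| ^ p * iteratedDeriv 1 φ x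
        - (iteratedDeriv 2 φ x ^ 2 + iteratedDeriv 0 φ x ^ 2)) x := by
    intro x
    have h0 := hder 0 (by norm_num) x
    have h1 := hder 1 (by norm_num) x
    have h2 := hder 2 (by norm_num) x
    have h3 := hder 3 (by norm_num) x
    have hp1 := (hasDerivAt_abs_rpow_sign (iteratedDeriv 1 φ x) hp).comp x h1
    refine ((((h3.mul h0).sub (h2.mul h1)).add ((h1.mul h0).const_mul ω)).add
      (hp1.mul h0)).congr_deriv ?_
    have he := heq x
    rw [← iteratedDeriv_one] at he
    simp only [Function.comp, iteratedDeriv_zero, Nat.reduceAdd]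
    linear_combination φ x * he
  have hFlim : Tendsto
      (fun x => iteratedDeriv 3 φ x * iteratedDeriv 0 φ x
        - iteratedDeriv 2 φ x * iteratedDeriv 1 φ x
        + ω * (iteratedDeriv 1 φ x * iteratedDeriv 0 φ x)
        + |iteratedDeriv 1 φ x| ^ p * iteratedDeriv 0 φ x) (cocompact ℝ) (𝓝 0) := by
    have h0 := hlim 0 (by norm_num)
    have h1 := hlim 1 (by norm_num)
    have h2 := hlim 2 (by norm_num)
    have h3 := hlim 3 (by norm_num)
    have hp1 := h1.abs.rpow_const (p := p) (Or.inr (by linarith))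
    simpa using (((h3.mul h0).sub (h2.mul h1)).add ((h1.mul h0).const_mul ω)).add (hp1.mul h0)
  have hB := (hsq 1 (by norm_num)).const_mul ω
  have hA : Integrable (fun x => iteratedDeriv 2 φ x ^ 2 + iteratedDeriv 0 φ x ^ 2) :=
    (hsq 2 (by norm_num)).add (hsq 0 (by norm_num))
  have hBN : Integrable (fun x => ω * iteratedDeriv 1 φ x ^ 2
      + |iteratedDeriv 1 φ x| ^ p * iteratedDeriv 1 φ x) := hB.add hN
  have key := integral_of_hasDerivAt_of_tendsto hF (hBN.sub hA)
    (hFlim.mono_left atBot_le_cocompact) (hFlim.mono_left atTop_le_cocompact)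
  rw [integral_sub hBN hA, integral_add hB hN, integral_const_mul] at key
  simp only [iteratedDeriv_zero, iteratedDeriv_succ] at key
  linarith

/-- If a decaying solution of `φ'''' + ωφ'' + φ + ∂_x(|φ'|^p) = 0` satisfies
`I[φ] < ∫ φ'²` and `∫ |φ'|^p φ' > 0`, then `ω < 2`. -/
theorem speed_below_two (p ω : ℝ) (hp : 1 < p) (φ : ℝ → ℝ) (hφ : ContDiff ℝ 4 φ)
    (C κ : ℝ) (hC : 0 < C) (hκ : 0 < κ)
    (hdecay : ∀ k ≤ 4, ∀ x : ℝ, |iteratedDeriv k φ x| ≤ C * Real.exp (-κ * |x|))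
    (heq : ∀ x : ℝ, iteratedDeriv 4 φ x + ω * iteratedDeriv 2 φ x + φ x
      + p * Real.sign (deriv φ x) * |deriv φ x| ^ (p - 1) * iteratedDeriv 2 φ x = 0)
    (hI : Ifun p φ < ∫ x : ℝ, (deriv φ x) ^ 2)
    (hpos : 0 < ∫ x : ℝ, |deriv φ x| ^ p * deriv φ x) :
    ω < 2 := by
  have hB : 0 ≤ ∫ x : ℝ, (deriv φ x) ^ 2 := integral_nonneg fun x => sq_nonneg _
  rw [Ifun, integral_energy_identity hp hφ hκ hdecay heq] at hI
  have hcoef : 1 / (p + 1) < 1 / 2 := one_div_lt_one_div_of_lt two_pos (by linarith)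
  have hNcoef := mul_lt_mul_of_pos_right hcoef hpos
  by_contra! hω
  have hωB := mul_le_mul_of_nonneg_right hω hB
  linarith
end

section
/- Let E be a real inner product space and T : E → E a linear map that is symmetric, i.e. ⟨Tx, y⟩ = ⟨x, Ty⟩ for all x, y ∈ E. Let ξ₀ ∈ E with ‖ξ₀‖ = 1 be such that ⟨Tx, x⟩ ≥ 0 for every x ∈ E with ⟨x, ξ₀⟩ = 0, and assume ⟨Tξ₀, ξ₀⟩ ≤ 0. Then for every y ∈ E with T y = ξ₀ one has ⟨y, ξ₀⟩ ≤ 0. -/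
open scoped RealInnerProductSpace

/-- Abstract stability lemma: if a symmetric operator `T` is nonnegative on the orthogonal
complement of a unit vector `ξ₀` and `⟪Tξ₀, ξ₀⟫ ≤ 0`, then any preimage `y` of `ξ₀`
under `T` satisfies `⟪y, ξ₀⟫ ≤ 0`. -/
theorem general_spectral_stability_lemma {E : Type*} [NormedAddCommGroup E]
    [InnerProductSpace ℝ E] (T : E →ₗ[ℝ] E)
    (hsym : ∀ x y : E, ⟪T x, y⟫ = ⟪x, T y⟫)
    (ξ₀ : E) (hnorm : ‖ξ₀‖ = 1)
    (hpos : ∀ x : E, ⟪x, ξ₀⟫ = 0 → 0 ≤ ⟪T x, x⟫)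
    (hneg : ⟪T ξ₀, ξ₀⟫ ≤ 0) :
    ∀ y : E, T y = ξ₀ → ⟪y, ξ₀⟫ ≤ 0 := by
  intro y hy
  have hself : ⟪ξ₀, ξ₀⟫ = 1 := by rw [real_inner_self_eq_norm_sq, hnorm, one_pow]
  have hTy : ⟪T ξ₀, y⟫ = 1 := by rw [hsym, hy, hself]
  have horth : ⟪y - ⟪y, ξ₀⟫ • ξ₀, ξ₀⟫ = 0 := by
    rw [inner_sub_left, real_inner_smul_left, hself, mul_one, sub_self]
  have hx := hpos _ horth
  rw [map_sub, map_smul, hy, inner_sub_left, real_inner_comm, horth, real_inner_smul_left,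
    inner_sub_right, real_inner_smul_right, hTy] at hx
  nlinarith [mul_nonpos_of_nonneg_of_nonpos (sq_nonneg ⟪y, ξ₀⟫) hneg]
end

section
/- Let E be a real inner product space and T : E → E a linear map that is symmetric, i.e. ⟨Tx, y⟩ = ⟨x, Ty⟩ for all x, y ∈ E. Let ξ₀ ∈ E with ξ₀ ≠ 0 be such that ⟨Tx, x⟩ ≥ 0 for every x ∈ E with ⟨x, ξ₀⟩ = 0, and assume ⟨Tξ₀, ξ₀⟩ < 0. Then every Ψ ∈ E with TΨ = 0 satisfies ⟨Ψ, ξ₀⟩ = 0; that is, the kernel of T is orthogonal to ξ₀. -/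
open scoped RealInnerProductSpace

/-- Abstract weak non-degeneracy: if a symmetric operator `T` is nonnegative on the
orthogonal complement of `ξ₀ ≠ 0` and `⟪Tξ₀, ξ₀⟫ < 0`, then the kernel of `T` is
orthogonal to `ξ₀`. -/
theorem kernel_orthogonal_to_wave {E : Type*} [NormedAddCommGroup E]
    [InnerProductSpace ℝ E] (T : E →ₗ[ℝ] E)
    (hsym : ∀ x y : E, ⟪T x, y⟫ = ⟪x, T y⟫)
    (ξ₀ : E) (hξ₀ : ξ₀ ≠ 0)
    (hpos : ∀ x : E, ⟪x, ξ₀⟫ = 0 → 0 ≤ ⟪T x, x⟫)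
    (hneg : ⟪T ξ₀, ξ₀⟫ < 0) :
    ∀ Ψ : E, T Ψ = 0 → ⟪Ψ, ξ₀⟫ = 0 := by
  intro Ψ hΨ
  by_contra h
  have horth : ⟪ξ₀ - (⟪ξ₀, ξ₀⟫ / ⟪Ψ, ξ₀⟫) • Ψ, ξ₀⟫ = 0 := by
    rw [inner_sub_left, real_inner_smul_left, div_mul_cancel₀ _ h, sub_self]
  have hnonneg := hpos _ horth
  rw [map_sub, map_smul, hΨ, smul_zero, sub_zero, inner_sub_right, real_inner_smul_right,
    hsym ξ₀ Ψ, hΨ, inner_zero_right, mul_zero, sub_zero] at hnonneg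
  exact hneg.not_ge hnonneg
end

section
/- Let p > 1 and let χ : ℝ → ℝ be a nonnegative Schwartz function which is not identically zero. Then there exist constants c > 0 and C ≥ 0 such that for every ε ∈ (0,1], ∫_ℝ χ(εx)^{p+1} |cos(x)|^{p+1} dx ≥ c/ε − C. Equivalently, the function v_ε(x) := 2√ε · χ(εx) cos(x) satisfies ∫_ℝ |v_ε(x)|^{p+1} dx ≥ c' ε^{(p−1)/2} for all sufficiently small ε > 0, for some c' > 0. -/
open MeasureTheory

/-- Bernoulli's inequality applied to `2 cos² x = 1 + cos 2x`. -/
lemma one_add_mul_cos_two_mul_le_abs_cos_rpow {q : ℝ} (hq : 2 ≤ q) (x : ℝ) :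
    (1 + q / 2 * Real.cos (2 * x)) ≤ 2 ^ (q / 2) * |Real.cos x| ^ q := by
  have h := one_add_mul_self_le_rpow_one_add (Real.neg_one_le_cos (2 * x))
    (show 1 ≤ q / 2 by linarith)
  have h2 : 1 + Real.cos (2 * x) = 2 * |Real.cos x| ^ (2 : ℝ) := by
    rw [Real.cos_two_mul, Real.rpow_two, sq_abs]
    ring
  rwa [h2, Real.mul_rpow zero_le_two (by positivity), ← Real.rpow_mul (abs_nonneg _),
    mul_div_cancel₀ q two_ne_zero] at h

lemma continuous_abs_cos_rpow {q : ℝ} (hq : 0 ≤ q) :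
    Continuous fun x : ℝ => |Real.cos x| ^ q :=
  Real.continuous_cos.abs.rpow_const fun _ => Or.inr hq

lemma sub_sub_le_integral_abs_cos_rpow {q : ℝ} (hq : 2 ≤ q) {u v : ℝ} (huv : u ≤ v) :
    v - u - q / 2 ≤ 2 ^ (q / 2) * ∫ x in u..v, |Real.cos x| ^ q := by
  have hcont := continuous_abs_cos_rpow (q := q) (by linarith)
  have hmono : ∫ x in u..v, (1 + q / 2 * Real.cos (2 * x))
      ≤ ∫ x in u..v, 2 ^ (q / 2) * |Real.cos x| ^ q :=
    intervalIntegral.integral_mono_on huv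
      (Continuous.intervalIntegrable (by fun_prop) _ _)
      ((continuous_const.mul hcont).intervalIntegrable _ _)
      fun x _ => one_add_mul_cos_two_mul_le_abs_cos_rpow hq x
  have hval : ∫ x in u..v, (1 + q / 2 * Real.cos (2 * x))
      = v - u + q / 2 * (2⁻¹ * (Real.sin (2 * v) - Real.sin (2 * u))) := by
    rw [intervalIntegral.integral_add (Continuous.intervalIntegrable (by fun_prop) _ _)
      (Continuous.intervalIntegrable (by fun_prop) _ _), intervalIntegral.integral_const_mul,
      intervalIntegral.integral_comp_mul_left (fun y => Real.cos y) two_ne_zero]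
    simp
  rw [intervalIntegral.integral_const_mul, hval] at hmono
  nlinarith [Real.neg_one_le_sin (2 * v), Real.sin_le_one (2 * u)]

lemma SchwartzMap.integrable_rpow_comp_mul_left_mul_abs_cos_rpow (χ : SchwartzMap ℝ ℝ)
    (hχ : ∀ x, 0 ≤ χ x) {q : ℝ} (hq : 1 ≤ q) {ε : ℝ} (hε : ε ≠ 0) :
    Integrable fun x : ℝ => χ (ε * x) ^ q * |Real.cos x| ^ q := by
  obtain ⟨M, hM⟩ : ∃ M, ∀ x, ‖χ x‖ ≤ M :=
    ⟨_, fun x => by simpa using χ.norm_le_seminorm ℝ x⟩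
  have hint : Integrable fun x : ℝ => M ^ (q - 1) * χ (ε * x) :=
    (χ.integrable.comp_mul_left' hε).const_mul _
  refine hint.mono' ?_ (Filter.Eventually.of_forall fun x => ?_)
  · refine (Continuous.mul ?_ (continuous_abs_cos_rpow (by linarith))).aestronglyMeasurable
    exact (χ.continuous.comp (continuous_const.mul continuous_id)).rpow_const
      fun _ => Or.inr (by linarith)
  · have h0 := hχ (ε * x)
    have hcos : |Real.cos x| ^ q ≤ 1 :=
      Real.rpow_le_one (abs_nonneg _) (Real.abs_cos_le_one x) (by linarith)
    rw [Real.norm_of_nonneg (by positivity)]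
    calc χ (ε * x) ^ q * |Real.cos x| ^ q ≤ χ (ε * x) ^ q :=
          mul_le_of_le_one_right (by positivity) hcos
      _ = χ (ε * x) ^ (q - 1) * χ (ε * x) := by
          rw [← Real.rpow_add_one' h0 (by linarith), sub_add_cancel]
      _ ≤ M ^ (q - 1) * χ (ε * x) := by
          gcongr
          exact (le_abs_self _).trans (hM _)

lemma Continuous.exists_pos_le_on_Icc {f : ℝ → ℝ} (hf : Continuous f) {x₀ : ℝ}
    (hx₀ : 0 < f x₀) : ∃ m > 0, ∃ a b, a < b ∧ ∀ x ∈ Set.Icc a b, m ≤ f x := by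
  have hev : ∀ᶠ x in nhds x₀, f x₀ / 2 < f x :=
    hf.continuousAt.eventually (lt_mem_nhds (half_lt_self hx₀))
  obtain ⟨δ, hδ, hball⟩ := Metric.nhds_basis_closedBall.eventually_iff.1 hev
  refine ⟨f x₀ / 2, half_pos hx₀, x₀ - δ, x₀ + δ, by linarith, fun x hx => (hball ?_).le⟩
  rwa [Real.closedBall_eq_Icc]

lemma SchwartzMap.exists_div_sub_le_integral_mul_abs_cos_rpow (χ : SchwartzMap ℝ ℝ)
    (hχ : ∀ x, 0 ≤ χ x) (hne : ∃ x, χ x ≠ 0) {q : ℝ} (hq : 2 ≤ q) :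
    ∃ c > (0 : ℝ), ∃ C ≥ (0 : ℝ), ∀ ε > (0 : ℝ),
      c / ε - C ≤ ∫ x : ℝ, χ (ε * x) ^ q * |Real.cos x| ^ q := by
  obtain ⟨x₀, hx₀⟩ := hne
  obtain ⟨m, hm, a, b, hab, hmle⟩ :=
    χ.continuous.exists_pos_le_on_Icc ((hχ x₀).lt_of_ne' hx₀)
  have hK : 0 < m ^ q / 2 ^ (q / 2) := by positivity
  refine ⟨m ^ q / 2 ^ (q / 2) * (b - a), mul_pos hK (sub_pos.2 hab),
    m ^ q / 2 ^ (q / 2) * (q / 2), by positivity, fun ε hε => ?_⟩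
  have hint := χ.integrable_rpow_comp_mul_left_mul_abs_cos_rpow hχ
    (show 1 ≤ q by linarith) hε.ne'
  have huv : a / ε ≤ b / ε := by gcongr
  calc m ^ q / 2 ^ (q / 2) * (b - a) / ε - m ^ q / 2 ^ (q / 2) * (q / 2)
      = m ^ q / 2 ^ (q / 2) * (b / ε - a / ε - q / 2) := by ring
    _ ≤ m ^ q / 2 ^ (q / 2) * (2 ^ (q / 2) * ∫ x in a / ε..b / ε, |Real.cos x| ^ q) := by
        gcongr
        exact sub_sub_le_integral_abs_cos_rpow hq huv
    _ = ∫ x in a / ε..b / ε, m ^ q * |Real.cos x| ^ q := by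
        rw [intervalIntegral.integral_const_mul]
        field_simp
    _ ≤ ∫ x in a / ε..b / ε, χ (ε * x) ^ q * |Real.cos x| ^ q := by
        refine intervalIntegral.integral_mono_on huv
          ((continuous_const.mul (continuous_abs_cos_rpow (by linarith))).intervalIntegrable _ _)
          hint.intervalIntegrable fun x hx => ?_
        gcongr
        refine hmle _ ⟨?_, ?_⟩
        · simpa [mul_comm] using (div_le_iff₀ hε).1 hx.1
        · simpa [mul_comm] using (le_div_iff₀ hε).1 hx.2
    _ ≤ ∫ x : ℝ, χ (ε * x) ^ q * |Real.cos x| ^ q := by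
        rw [intervalIntegral.integral_of_le huv]
        refine setIntegral_le_integral hint (Filter.Eventually.of_forall fun x => ?_)
        have h0 := hχ (ε * x)
        change 0 ≤ χ (ε * x) ^ q * |Real.cos x| ^ q
        positivity

/-- Lower bound `c/ε - C` for `∫ χ(εx)^{p+1} |cos(x)|^{p+1} dx`, and the equivalent lower
bound `c' ε^{(p-1)/2}` for the `L^{p+1}` norm of `v_ε(x) = 2√ε χ(εx) cos x`. -/
theorem cosine_modulated_lower_bound (p : ℝ) (hp : 1 < p) (χ : SchwartzMap ℝ ℝ)
    (hχ : ∀ x : ℝ, 0 ≤ χ x) (hne : ∃ x : ℝ, χ x ≠ 0) :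
    (∃ c > (0 : ℝ), ∃ C ≥ (0 : ℝ), ∀ ε ∈ Set.Ioc (0 : ℝ) 1,
      c / ε - C ≤ ∫ x : ℝ, (χ (ε * x) : ℝ) ^ (p + 1) * |Real.cos x| ^ (p + 1)) ∧
    ∃ c' > (0 : ℝ), ∃ ε₀ > (0 : ℝ), ∀ ε ∈ Set.Ioc (0 : ℝ) ε₀,
      c' * ε ^ ((p - 1) / 2)
        ≤ ∫ x : ℝ, |2 * Real.sqrt ε * (χ (ε * x) : ℝ) * Real.cos x| ^ (p + 1) := by
  obtain ⟨c, hc, C, hC, h⟩ :=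
    χ.exists_div_sub_le_integral_mul_abs_cos_rpow hχ hne (show 2 ≤ p + 1 by linarith)
  refine ⟨⟨c, hc, C, hC, fun ε hε => h ε hε.1⟩,
    2 ^ (p + 1) * (c / 2), by positivity, c / (2 * (C + 1)), by positivity, ?_⟩
  rintro ε ⟨hε, hle⟩
  have hhalf : c / 2 / ε ≤ c / ε - C := by
    rw [le_div_iff₀ (by positivity)] at hle
    rw [le_sub_iff_add_le, ← le_sub_iff_add_le', ← sub_div, le_div_iff₀ hε]
    nlinarith
  have hpow : ε ^ ((p - 1) / 2) = Real.sqrt ε ^ (p + 1) / ε := by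
    rw [Real.sqrt_eq_rpow, ← Real.rpow_mul hε.le, ← Real.rpow_sub_one hε.ne']
    congr 1
    ring
  have hscale (x : ℝ) : |2 * Real.sqrt ε * χ (ε * x) * Real.cos x| ^ (p + 1)
      = 2 ^ (p + 1) * Real.sqrt ε ^ (p + 1)
        * (χ (ε * x) ^ (p + 1) * |Real.cos x| ^ (p + 1)) := by
    have h0 := hχ (ε * x)
    rw [abs_mul, abs_of_nonneg (show 0 ≤ 2 * Real.sqrt ε * χ (ε * x) by positivity),
      Real.mul_rpow (by positivity) (abs_nonneg _), Real.mul_rpow (by positivity) h0,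
      Real.mul_rpow zero_le_two (Real.sqrt_nonneg _), mul_assoc]
  simp_rw [hscale]
  rw [integral_const_mul, hpow]
  calc 2 ^ (p + 1) * (c / 2) * (Real.sqrt ε ^ (p + 1) / ε)
      = 2 ^ (p + 1) * Real.sqrt ε ^ (p + 1) * (c / 2 / ε) := by ring
    _ ≤ _ := by
        gcongr
        exact hhalf.trans (h ε hε)
end
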